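/- arXiv:2602.10767 — 4 statements merged into one kernel-verified Lean document; each statement's English description precedes it below -/
import Mathlib

section
/- For every real m > 0, the variance of the Nakagami-m phase distribution about its mean π satisfies ∫₀^{2π} (θ − π)² · f_Θ(θ) dθ = π²/4 + (∫₀^π t² (sin t)^{m−1} dt) / (4√π C(m)). -/
open Real

/-- `C(m) = Γ(m/2) / Γ((m+1)/2)`. -/
noncomputable def Cnak (m : ℝ) : ℝ := Real.Gamma (m / 2) / Real.Gamma ((m + 1) / 2)

/-- The Nakagami-`m` phase density on `[0, 2π]`:
`f_Θ(θ) = |sin 2θ|^(m-1) / (2 √π C(m))`. -/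
noncomputable def nakPhasePDF (m θ : ℝ) : ℝ :=
  |Real.sin (2 * θ)| ^ (m - 1) / (2 * Real.sqrt π * Cnak m)

open MeasureTheory Set in
theorem integrableOn_and_integral_rpow_mul_one_sub_rpow {a b : ℝ} (ha : 0 < a) (hb : 0 < b) :
    IntegrableOn (fun x : ℝ => x ^ (a - 1) * (1 - x) ^ (b - 1)) (Ioo 0 1) ∧
      ∫ x in Ioo (0 : ℝ) 1, x ^ (a - 1) * (1 - x) ^ (b - 1) =
        Real.Gamma a * Real.Gamma b / Real.Gamma (a + b) := by
  have hcongr : ∀ x ∈ Ioo (0 : ℝ) 1,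
      (x : ℂ) ^ ((a : ℂ) - 1) * (1 - (x : ℂ)) ^ ((b : ℂ) - 1) =
        ((x ^ (a - 1) * (1 - x) ^ (b - 1) : ℝ) : ℂ) := by
    intro x hx
    push_cast
    rw [Complex.ofReal_cpow hx.1.le, Complex.ofReal_cpow (sub_nonneg.2 hx.2.le)]
    push_cast
    rfl
  have hInt := Complex.betaIntegral_convergent (u := a) (v := b) (by simpa) (by simpa)
  rw [intervalIntegrable_iff_integrableOn_Ioo_of_le zero_le_one,
    integrableOn_congr_fun hcongr measurableSet_Ioo] at hInt
  refine ⟨by simpa [IntegrableOn] using! hInt.re, ?_⟩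
  have hbeta := ProbabilityTheory.beta_eq_betaIntegralReal a b ha hb
  rw [Complex.betaIntegral, intervalIntegral.integral_of_le zero_le_one,
    integral_Ioc_eq_integral_Ioo, setIntegral_congr_fun measurableSet_Ioo hcongr,
    integral_complex_ofReal, Complex.ofReal_re] at hbeta
  exact hbeta.symm

open Set in
theorem image_one_sub_cos_div_two_Ioo :
    (fun t : ℝ => (1 - Real.cos t) / 2) '' Ioo 0 π = Ioo 0 1 := by
  ext x
  constructor
  · rintro ⟨t, ht, rfl⟩
    have h1 := Real.cos_lt_cos_of_nonneg_of_le_pi le_rfl ht.2.le ht.1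
    have h2 := Real.cos_lt_cos_of_nonneg_of_le_pi ht.1.le le_rfl ht.2
    rw [Real.cos_zero] at h1
    rw [Real.cos_pi] at h2
    constructor <;> dsimp only <;> linarith
  · rintro ⟨h0, h1⟩
    refine ⟨Real.arccos (1 - 2 * x), ⟨Real.arccos_pos.2 (by linarith), ?_⟩, ?_⟩
    · refine lt_of_le_of_ne (Real.arccos_le_pi _) fun h => ?_
      rw [Real.arccos_eq_pi] at h
      linarith
    · dsimp only
      rw [Real.cos_arccos (by linarith) (by linarith)]
      ring

open MeasureTheory Set in
theorem intervalIntegrable_and_integral_sin_rpow {m : ℝ} (hm : 0 < m) :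
    IntervalIntegrable (fun t => Real.sin t ^ (m - 1)) volume 0 π ∧
      ∫ t in (0 : ℝ)..π, Real.sin t ^ (m - 1) = Real.sqrt π * Cnak m := by
  have hm2 : 0 < m / 2 := half_pos hm
  obtain ⟨hInt, hval⟩ := integrableOn_and_integral_rpow_mul_one_sub_rpow hm2 hm2
  have hderiv : ∀ t ∈ Ioo 0 π,
      HasDerivWithinAt (fun t : ℝ => (1 - Real.cos t) / 2) (Real.sin t / 2) (Ioo 0 π) t := by
    intro t _
    simpa using (((Real.hasDerivAt_cos t).const_sub 1).div_const 2).hasDerivWithinAt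
  have hinj : InjOn (fun t : ℝ => (1 - Real.cos t) / 2) (Ioo 0 π) := by
    intro s hs t ht hst
    refine Real.injOn_cos (Ioo_subset_Icc_self hs) (Ioo_subset_Icc_self ht) ?_
    dsimp only at hst
    linarith
  have hcongr : ∀ t ∈ Ioo 0 π,
      |Real.sin t / 2| • (((1 - Real.cos t) / 2) ^ (m / 2 - 1) *
        (1 - (1 - Real.cos t) / 2) ^ (m / 2 - 1)) =
      (2 : ℝ) ^ (1 - m) * Real.sin t ^ (m - 1) := by
    intro t ht
    have hs : 0 < Real.sin t := Real.sin_pos_of_mem_Ioo ht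
    have hs2 : 0 < Real.sin t / 2 := half_pos hs
    have hcos := Real.cos_le_one t
    have hcos' := Real.neg_one_le_cos t
    rw [← Real.mul_rpow (by linarith) (by linarith),
      show (1 - Real.cos t) / 2 * (1 - (1 - Real.cos t) / 2) = (Real.sin t / 2) ^ (2 : ℝ) by
        rw [Real.rpow_two]; linear_combination (-1 / 4) * Real.sin_sq_add_cos_sq t,
      ← Real.rpow_mul hs2.le, abs_of_pos hs2, smul_eq_mul, mul_comm, ← Real.rpow_add_one hs2.ne',
      show 2 * (m / 2 - 1) + 1 = m - 1 by ring, Real.div_rpow hs.le zero_le_two,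
      show 1 - m = -(m - 1) by ring, Real.rpow_neg zero_le_two]
    ring
  have h2 : (2 : ℝ) ^ (1 - m) ≠ 0 := (Real.rpow_pos_of_pos two_pos _).ne'
  rw [← image_one_sub_cos_div_two_Ioo,
    integrableOn_image_iff_integrableOn_abs_deriv_smul measurableSet_Ioo hderiv hinj,
    integrableOn_congr_fun hcongr measurableSet_Ioo] at hInt
  rw [← image_one_sub_cos_div_two_Ioo,
    integral_image_eq_integral_abs_deriv_smul measurableSet_Ioo hderiv hinj,
    setIntegral_congr_fun measurableSet_Ioo hcongr, integral_const_mul] at hval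
  constructor
  · rw [intervalIntegrable_iff_integrableOn_Ioo_of_le pi_pos.le]
    simpa [IntegrableOn, h2] using! hInt.const_mul ((2 : ℝ) ^ (1 - m))⁻¹
  · rw [intervalIntegral.integral_of_le pi_pos.le, integral_Ioc_eq_integral_Ioo]
    refine mul_left_cancel₀ h2 (hval.trans ?_)
    have hdup := Real.Gamma_mul_Gamma_add_half (m / 2)
    rw [show m / 2 + 1 / 2 = (m + 1) / 2 by ring, show 2 * (m / 2) = m by ring] at hdup
    have hG := (Real.Gamma_pos_of_pos hm).ne'
    have hG' := (Real.Gamma_pos_of_pos (show 0 < (m + 1) / 2 by linarith)).ne'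
    rw [add_halves, Cnak]
    field_simp
    linear_combination hdup

open MeasureTheory in
theorem integral_zero_four_pi_mul_abs_sin_rpow {f : ℝ → ℝ} (hf : Continuous f) {p : ℝ}
    (hp : IntervalIntegrable (fun t => Real.sin t ^ p) volume 0 π) :
    ∫ t in (0 : ℝ)..(4 * π), f t * |Real.sin t| ^ p =
      ∫ t in (0 : ℝ)..π,
        (f t + f (t + π) + f (t + 2 * π) + f (t + 3 * π)) * Real.sin t ^ p := by
  have hshift (k : ℕ) : ∀ t ∈ Set.uIcc 0 π,
      f (t + k * π) * Real.sin t ^ p = f (t + k * π) * |Real.sin (t + k * π)| ^ p := by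
    intro t ht
    rw [Set.uIcc_of_le pi_pos.le] at ht
    rw [Real.sin_add_nat_mul_pi, abs_mul, abs_pow, abs_neg, abs_one, one_pow, one_mul,
      abs_of_nonneg (Real.sin_nonneg_of_mem_Icc ht)]
  have hcont (k : ℕ) :
      IntervalIntegrable (fun t => f (t + k * π) * Real.sin t ^ p) volume 0 π :=
    hp.continuousOn_mul (by fun_prop)
  have hpiece (k : ℕ) : IntervalIntegrable (fun t => f t * |Real.sin t| ^ p) volume
      (k * π) ((k + 1 : ℕ) * π) := by
    have h := ((hcont k).congr fun t ht => hshift k t (Set.uIoc_subset_uIcc ht)).comp_sub_right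
      (k * π)
    simpa [add_mul, add_comm] using h
  have hval (k : ℕ) : ∫ t in (k * π)..((k + 1 : ℕ) * π), f t * |Real.sin t| ^ p =
      ∫ t in (0 : ℝ)..π, f (t + k * π) * Real.sin t ^ p := by
    rw [intervalIntegral.integral_congr (hshift k),
      intervalIntegral.integral_comp_add_right (fun t => f t * |Real.sin t| ^ p)]
    congr 1 <;> push_cast <;> ring
  have hsum := intervalIntegral.sum_integral_adjacent_intervals (n := 4)
    (a := fun k : ℕ => k * π) fun k _ => hpiece k
  simp only [hval] at hsum
  rw [← intervalIntegral.integral_finsetSum fun k _ => hcont k] at hsum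
  simp only [Finset.sum_range_succ, Finset.sum_range_zero] at hsum
  norm_num at hsum
  rw [← hsum]
  congr 1 with t
  ring

/-- For every real `m > 0`, the variance of the Nakagami-`m` phase distribution about
its mean `π` satisfies
`∫₀^{2π} (θ − π)² f_Θ(θ) dθ = π²/4 + (∫₀^π t² (sin t)^(m−1) dt) / (4 √π C(m))`. -/
theorem nakagami_phase_variance (m : ℝ) (hm : 0 < m) :
    ∫ θ in (0:ℝ)..(2 * π), (θ - π) ^ 2 * nakPhasePDF m θ =
      π ^ 2 / 4 +
        (∫ t in (0:ℝ)..π, t ^ 2 * Real.sin t ^ (m - 1)) / (4 * Real.sqrt π * Cnak m) := by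
  obtain ⟨hInt, hval⟩ := intervalIntegrable_and_integral_sin_rpow hm
  have hC : 0 < Cnak m :=
    div_pos (Real.Gamma_pos_of_pos (by linarith)) (Real.Gamma_pos_of_pos (by linarith))
  have hpi : 0 < Real.sqrt π := Real.sqrt_pos.2 pi_pos
  have hInt1 : IntervalIntegrable (fun t => t * Real.sin t ^ (m - 1)) MeasureTheory.volume 0 π :=
    hInt.continuousOn_mul (by fun_prop)
  have hInt2 : IntervalIntegrable (fun t => t ^ 2 * Real.sin t ^ (m - 1))
      MeasureTheory.volume 0 π := hInt.continuousOn_mul (by fun_prop)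
  have hmean : ∫ t in (0 : ℝ)..π, t * Real.sin t ^ (m - 1) =
      π / 2 * ∫ t in (0 : ℝ)..π, Real.sin t ^ (m - 1) := by
    have h := intervalIntegral.integral_comp_sub_left (a := 0) (b := π)
      (fun t => t * Real.sin t ^ (m - 1)) π
    simp only [Real.sin_pi_sub, sub_mul, sub_self, sub_zero] at h
    rw [intervalIntegral.integral_sub (hInt.const_mul π) hInt1,
      intervalIntegral.integral_const_mul] at h
    linear_combination (-1 / 2) * h
  have hscale : ∫ θ in (0:ℝ)..(2 * π), (θ - π) ^ 2 * nakPhasePDF m θ =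
      (16 * Real.sqrt π * Cnak m)⁻¹ *
        ∫ φ in (0:ℝ)..(4 * π), (φ - 2 * π) ^ 2 * |Real.sin φ| ^ (m - 1) := by
    have h := intervalIntegral.integral_comp_mul_left (a := 0) (b := 2 * π)
      (fun φ => (φ - 2 * π) ^ 2 * |Real.sin φ| ^ (m - 1)) (two_ne_zero (α := ℝ))
    rw [mul_zero, show 2 * (2 * π) = 4 * π by ring, smul_eq_mul] at h
    rw [show (16 * Real.sqrt π * Cnak m)⁻¹ = (8 * Real.sqrt π * Cnak m)⁻¹ * 2⁻¹ by
      rw [← mul_inv]; ring, mul_assoc, ← h, ← intervalIntegral.integral_const_mul]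
    refine intervalIntegral.integral_congr fun θ _ => ?_
    simp only [nakPhasePDF]
    field_simp
    ring
  rw [hscale, integral_zero_four_pi_mul_abs_sin_rpow (by fun_prop) hInt]
  have hexpand (t : ℝ) :
      ((t - 2 * π) ^ 2 + (t + π - 2 * π) ^ 2 + (t + 2 * π - 2 * π) ^ 2 +
        (t + 3 * π - 2 * π) ^ 2) * Real.sin t ^ (m - 1) =
      4 * (t ^ 2 * Real.sin t ^ (m - 1)) - 4 * π * (t * Real.sin t ^ (m - 1)) +
        6 * π ^ 2 * Real.sin t ^ (m - 1) := by
    ring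
  simp only [hexpand]
  rw [intervalIntegral.integral_add ((hInt2.const_mul _).sub (hInt1.const_mul _))
      (hInt.const_mul _),
    intervalIntegral.integral_sub (hInt2.const_mul _) (hInt1.const_mul _)]
  simp only [intervalIntegral.integral_const_mul]
  rw [hmean, hval]
  field_simp
  ring
end

section
/- For every σ > 0, c ≥ 0, and real φ, ∫_ℝ (1/(√(2π) σ)) e^{−ϑ²/(2σ²)} e^{−c cos(ϑ − φ)} dϑ = I₀(c) + 2 ∑_{k=1}^∞ (−1)^k e^{−σ² k²/2} cos(k φ) I_k(c), where the series on the right converges absolutely. -/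
open Real

/-- The modified Bessel function of the first kind of integer order `k`:
`I_k(z) = ∑ₙ (z/2)^(2n+k) / (n! (n+k)!)`. -/
noncomputable def besselI (k : ℕ) (z : ℝ) : ℝ :=
  ∑' n : ℕ, (z / 2) ^ (2 * n + k) / ((n.factorial : ℝ) * ((n + k).factorial : ℝ))

open MeasureTheory ProbabilityTheory

/-- Pairs of naturals, parametrized by their difference and their minimum. -/
def intProdNatEquivNatProdNat : ℤ × ℕ ≃ ℕ × ℕ where
  toFun p := (p.2 + p.1.toNat, p.2 + (-p.1).toNat)
  invFun q := ((q.1 : ℤ) - q.2, min q.1 q.2)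
  left_inv := by
    rintro ⟨k, n⟩
    ext <;> simp only <;> omega
  right_inv := by
    rintro ⟨a, b⟩
    ext <;> simp only <;> omega

theorem pow_div_factorial_mul_pow_div_factorial (x θ : ℝ) (a b : ℕ) :
    ((x : ℂ) * Complex.exp (θ * Complex.I)) ^ a / (a.factorial : ℂ) *
        (((x : ℂ) * Complex.exp (-(θ * Complex.I))) ^ b / (b.factorial : ℂ)) =
      (x ^ (a + b) / ((a.factorial : ℝ) * (b.factorial : ℝ)) : ℝ) *
        Complex.exp ((((a : ℝ) - b) * θ : ℝ) * Complex.I) := by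
  have hsplit : Complex.exp ((((a : ℝ) - b) * θ : ℝ) * Complex.I) =
      Complex.exp (a * (θ * Complex.I)) * Complex.exp (b * -(θ * Complex.I)) := by
    rw [← Complex.exp_add]
    push_cast
    congr 1
    ring
  rw [mul_pow, mul_pow, ← Complex.exp_nat_mul, ← Complex.exp_nat_mul, hsplit]
  generalize Complex.exp (a * (θ * Complex.I)) = u
  generalize Complex.exp (b * -(θ * Complex.I)) = v
  push_cast
  rw [pow_add, div_mul_div_comm, div_mul_eq_mul_div]
  congr 1
  ring

theorem exp_mul_exp_eq_exp_mul_cos (z θ : ℝ) :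
    Complex.exp ((z / 2 : ℝ) * Complex.exp (θ * Complex.I)) *
      Complex.exp ((z / 2 : ℝ) * Complex.exp (-(θ * Complex.I))) =
      (Real.exp (z * Real.cos θ) : ℝ) := by
  rw [← Complex.exp_add]
  push_cast
  rw [Complex.cos, ← neg_mul]
  congr 1
  ring

theorem Complex.hasSum_pow_div_factorial (w : ℂ) :
    HasSum (fun n : ℕ => w ^ n / (n.factorial : ℂ)) (Complex.exp w) := by
  rw [Complex.exp_eq_exp_ℂ]
  exact NormedSpace.expSeries_div_hasSum_exp w

theorem Complex.hasSum_pow_div_factorial_mul (u v : ℂ) :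
    HasSum (fun p : ℕ × ℕ => u ^ p.1 / (p.1.factorial : ℂ) * (v ^ p.2 / (p.2.factorial : ℂ)))
      (Complex.exp u * Complex.exp v) := by
  have hu : Summable fun n : ℕ => ‖u ^ n / (n.factorial : ℂ)‖ :=
    NormedSpace.norm_expSeries_div_summable u
  have hv : Summable fun n : ℕ => ‖v ^ n / (n.factorial : ℂ)‖ :=
    NormedSpace.norm_expSeries_div_summable v
  have hs := summable_mul_of_summable_norm hu hv
  have h := tsum_mul_tsum_of_summable_norm hu hv
  rw [(Complex.hasSum_pow_div_factorial u).tsum_eq,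
    (Complex.hasSum_pow_div_factorial v).tsum_eq] at h
  rw [h]
  exact hs.hasSum

theorem hasSum_exp_mul_cos_prod (z θ : ℝ) :
    HasSum (fun p : ℕ × ℕ => (z / 2) ^ (p.1 + p.2) / ((p.1.factorial : ℝ) * (p.2.factorial : ℝ)) *
      Real.cos (((p.1 : ℝ) - p.2) * θ)) (Real.exp (z * Real.cos θ)) := by
  have h := Complex.hasSum_pow_div_factorial_mul ((z / 2 : ℝ) * Complex.exp (θ * Complex.I))
    ((z / 2 : ℝ) * Complex.exp (-(θ * Complex.I)))
  rw [exp_mul_exp_eq_exp_mul_cos] at h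
  simp only [pow_div_factorial_mul_pow_div_factorial] at h
  have hre := Complex.hasSum_re h
  simpa only [Complex.re_ofReal_mul, Complex.exp_ofReal_mul_I_re, Complex.ofReal_re] using hre

/-- The Jacobi–Anger expansion, as a sum over all integers. -/
theorem hasSum_int_besselI_mul_cos (z θ : ℝ) :
    HasSum (fun k : ℤ => besselI k.natAbs z * Real.cos (k * θ)) (Real.exp (z * Real.cos θ)) := by
  have h := intProdNatEquivNatProdNat.hasSum_iff.mpr (hasSum_exp_mul_cos_prod z θ)
  have hterm : ∀ (k : ℤ) (n : ℕ),
      ((fun p : ℕ × ℕ => (z / 2) ^ (p.1 + p.2) / ((p.1.factorial : ℝ) * (p.2.factorial : ℝ)) *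
        Real.cos (((p.1 : ℝ) - p.2) * θ)) ∘ intProdNatEquivNatProdNat) (k, n) =
      (z / 2) ^ (2 * n + k.natAbs) / ((n.factorial : ℝ) * ((n + k.natAbs).factorial : ℝ)) *
        Real.cos (k * θ) := by
    intro k n
    obtain ⟨m, rfl | rfl⟩ := k.eq_nat_or_neg
    · simp [intProdNatEquivNatProdNat]
      ring_nf
      simp
    · simp [intProdNatEquivNatProdNat]
      ring_nf
      simp
  refine h.prod_fiberwise fun k => ?_
  have hk := (h.summable.prod_factor k).hasSum
  simp only [hterm] at hk ⊢
  rwa [tsum_mul_right] at hk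

theorem summable_abs_besselI (z : ℝ) : Summable fun k : ℤ => |besselI k.natAbs z| := by
  simpa using (hasSum_int_besselI_mul_cos z 0).summable.abs

theorem besselI_neg (k : ℕ) (z : ℝ) : besselI k (-z) = (-1) ^ k * besselI k z := by
  rw [besselI, besselI, ← tsum_mul_left]
  refine tsum_congr fun n => ?_
  rw [neg_div, neg_pow, pow_add (-1 : ℝ), pow_mul]
  norm_num
  ring

theorem integral_cos_mul_sub_gaussianReal (v : NNReal) (t φ : ℝ) :
    ∫ ϑ, Real.cos (t * (ϑ - φ)) ∂gaussianReal 0 v =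
      Real.cos (t * φ) * Real.exp (-(v * t ^ 2) / 2) := by
  have hint : Integrable (fun ϑ : ℝ => Complex.exp ((t * (ϑ - φ) : ℝ) * Complex.I))
      (gaussianReal 0 v) := by
    refine Integrable.of_bound (by fun_prop) 1 (ae_of_all _ fun ϑ => ?_)
    rw [Complex.norm_exp_ofReal_mul_I]
  have hre := integral_re hint
  simp only [RCLike.re_to_complex, Complex.exp_ofReal_mul_I_re] at hre
  rw [hre]
  have hsplit : (fun ϑ : ℝ => Complex.exp ((t * (ϑ - φ) : ℝ) * Complex.I)) =
      fun ϑ : ℝ => Complex.exp ((-(t * φ) : ℝ) * Complex.I) *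
        Complex.exp (t * ϑ * Complex.I) := by
    ext ϑ
    rw [← Complex.exp_add]
    push_cast
    congr 1
    ring
  rw [hsplit, integral_const_mul, ← charFun_apply_real, charFun_gaussianReal]
  have hexp : Complex.exp (t * (0 : ℝ) * Complex.I - v * t ^ 2 / 2) =
      (Real.exp (-(v * t ^ 2) / 2) : ℝ) := by
    push_cast
    congr 1
    ring
  rw [hexp, Complex.re_mul_ofReal, Complex.exp_ofReal_mul_I_re, Real.cos_neg]

theorem hasSum_integral_exp_mul_cos_gaussianReal (v : NNReal) (z φ : ℝ) :
    HasSum (fun k : ℤ => besselI k.natAbs z *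
        (Real.cos (k * φ) * Real.exp (-(v * (k : ℝ) ^ 2) / 2)))
      (∫ ϑ, Real.exp (z * Real.cos (ϑ - φ)) ∂gaussianReal 0 v) := by
  have h := hasSum_integral_of_dominated_convergence (μ := gaussianReal 0 v)
    (F := fun (k : ℤ) (ϑ : ℝ) => besselI k.natAbs z * Real.cos (k * (ϑ - φ)))
    (f := fun ϑ => Real.exp (z * Real.cos (ϑ - φ)))
    (fun k _ => |besselI k.natAbs z|) (fun k => by fun_prop)
    (fun k => ae_of_all _ fun ϑ => by
      rw [Real.norm_eq_abs, abs_mul]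
      exact mul_le_of_le_one_right (abs_nonneg _) (Real.abs_cos_le_one _))
    (ae_of_all _ fun _ => summable_abs_besselI z)
    (integrable_const _)
    (ae_of_all _ fun ϑ => hasSum_int_besselI_mul_cos z (ϑ - φ))
  simpa only [integral_const_mul, integral_cos_mul_sub_gaussianReal] using h

/-- For every `σ > 0`, `c ≥ 0`, and real `φ`,
`∫_ℝ (1/(√(2π) σ)) e^{−ϑ²/(2σ²)} e^{−c cos(ϑ − φ)} dϑ
  = I₀(c) + 2 ∑_{k=1}^∞ (−1)^k e^{−σ² k²/2} cos(k φ) I_k(c)`,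
where the series on the right converges absolutely. -/
theorem gaussian_phase_average_exp_cos (σ : ℝ) (hσ : 0 < σ) (c : ℝ) (hc : 0 ≤ c) (φ : ℝ) :
    (Summable fun k : ℕ =>
        |(-1 : ℝ) ^ (k + 1) * Real.exp (-(σ ^ 2 * ((k : ℝ) + 1) ^ 2) / 2) *
          Real.cos (((k : ℝ) + 1) * φ) * besselI (k + 1) c|) ∧
      (∫ ϑ : ℝ, (1 / (Real.sqrt (2 * π) * σ)) * Real.exp (-ϑ ^ 2 / (2 * σ ^ 2)) *
          Real.exp (-c * Real.cos (ϑ - φ))) =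
        besselI 0 c +
          2 * ∑' k : ℕ, (-1 : ℝ) ^ (k + 1) *
            Real.exp (-(σ ^ 2 * ((k : ℝ) + 1) ^ 2) / 2) *
            Real.cos (((k : ℝ) + 1) * φ) * besselI (k + 1) c := by
  have hv : (σ ^ 2).toNNReal ≠ 0 := by
    simpa using hσ.ne'
  have hcoe : ((σ ^ 2).toNNReal : ℝ) = σ ^ 2 := Real.coe_toNNReal _ (sq_nonneg σ)
  have hint : (∫ ϑ : ℝ, (1 / (Real.sqrt (2 * π) * σ)) * Real.exp (-ϑ ^ 2 / (2 * σ ^ 2)) *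
      Real.exp (-c * Real.cos (ϑ - φ))) =
      ∫ ϑ, Real.exp (-c * Real.cos (ϑ - φ)) ∂gaussianReal 0 (σ ^ 2).toNNReal := by
    rw [integral_gaussianReal_eq_integral_smul hv]
    refine integral_congr_ae (ae_of_all _ fun ϑ => ?_)
    simp only [gaussianPDFReal, hcoe, smul_eq_mul, sub_zero, one_div]
    rw [Real.sqrt_mul (by positivity) (σ ^ 2), Real.sqrt_sq hσ.le]
  have h := (hasSum_integral_exp_mul_cos_gaussianReal (σ ^ 2).toNNReal (-c) φ).nat_add_neg
  rw [← hasSum_nat_add_iff' 1, ← hint] at h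
  set J := ∫ ϑ : ℝ, (1 / (Real.sqrt (2 * π) * σ)) * Real.exp (-ϑ ^ 2 / (2 * σ ^ 2)) *
      Real.exp (-c * Real.cos (ϑ - φ))
  have h2 : HasSum (fun k : ℕ => 2 * ((-1 : ℝ) ^ (k + 1) *
      Real.exp (-(σ ^ 2 * ((k : ℝ) + 1) ^ 2) / 2) *
      Real.cos (((k : ℝ) + 1) * φ) * besselI (k + 1) c)) (J - besselI 0 c) := by
    have hlim : J - besselI 0 c = J + besselI (Int.natAbs 0) (-c) *
        (Real.cos ((0 : ℤ) * φ) * Real.exp (-((σ ^ 2).toNNReal * ((0 : ℤ) : ℝ) ^ 2) / 2)) -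
        ∑ i ∈ Finset.range 1, (besselI (i : ℤ).natAbs (-c) * (Real.cos ((i : ℤ) * φ) *
          Real.exp (-((σ ^ 2).toNNReal * ((i : ℤ) : ℝ) ^ 2) / 2)) +
          besselI (-(i : ℤ)).natAbs (-c) * (Real.cos ((-(i : ℤ) : ℤ) * φ) *
          Real.exp (-((σ ^ 2).toNNReal * ((-(i : ℤ) : ℤ) : ℝ) ^ 2) / 2))) := by
      simp [besselI_neg]
    rw [hlim]
    refine h.congr_fun fun k => ?_
    simp only [Int.natAbs_neg, Int.natAbs_natCast, besselI_neg, hcoe, Int.cast_neg,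
      Int.cast_natCast, neg_mul, Real.cos_neg, neg_sq]
    push_cast
    ring
  refine ⟨((summable_mul_left_iff two_ne_zero).mp h2.summable).abs, ?_⟩
  rw [← tsum_mul_left, h2.tsum_eq]
  ring
end

section
/- For every real m > 0, β > 0, r ≥ 0, and integer k ≥ 0, ∫₀^∞ a^{2m−1} e^{−β a²} I_k(2 a r) da = (Γ(m + k/2) / (2 β^{m+k/2} k!)) · r^k · ₁F₁(m + k/2; k+1; r²/β). -/
open Real

/-- The Pochhammer symbol `(x)_n = x (x+1) ⋯ (x+n−1)` over the reals. -/
noncomputable def poch (x : ℝ) (n : ℕ) : ℝ := (ascPochhammer ℝ n).eval x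

/-- The confluent hypergeometric function of the first kind
`₁F₁(a; b; z) = ∑ₙ ((a)ₙ / (b)ₙ) zⁿ / n!`. -/
noncomputable def oneF1 (a b z : ℝ) : ℝ :=
  ∑' n : ℕ, poch a n / poch b n * z ^ n / (n.factorial : ℝ)

open MeasureTheory Set

lemma poch_zero (x : ℝ) : poch x 0 = 1 := by simp [poch]

lemma poch_succ (x : ℝ) (n : ℕ) : poch x (n + 1) = poch x n * (x + n) := by
  simp [poch, ascPochhammer_succ_eval]

lemma poch_pos {x : ℝ} (hx : 0 < x) (n : ℕ) : 0 < poch x n :=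
  ascPochhammer_pos n x hx

lemma Gamma_add_natCast_eq_poch_mul {s : ℝ} (hs : 0 < s) (n : ℕ) :
    Real.Gamma (s + n) = poch s n * Real.Gamma s := by
  induction n with
  | zero => simp [poch_zero]
  | succ n ih =>
    have h : s + n ≠ 0 := by positivity
    rw [Nat.cast_succ, ← add_assoc, Real.Gamma_add_one h, ih, poch_succ]
    ring

lemma factorial_add_eq_factorial_mul_poch (k n : ℕ) :
    ((n + k).factorial : ℝ) = k.factorial * poch ((k : ℝ) + 1) n := by
  induction n with
  | zero => simp [poch_zero]
  | succ n ih =>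
    rw [show n + 1 + k = n + k + 1 by ring, Nat.factorial_succ, Nat.cast_mul, ih, poch_succ]
    push_cast
    ring

lemma poch_le_pow_mul_poch {s b : ℝ} (hs : 0 < s) (hb : 1 ≤ b) (n : ℕ) :
    poch s n ≤ (s + 1) ^ n * poch b n := by
  induction n with
  | zero => simp [poch_zero]
  | succ n ih =>
    have hp : 0 < poch b n := poch_pos (by linarith) n
    have h : s + n ≤ (s + 1) * (b + n) := by
      have hn : (0 : ℝ) ≤ n := n.cast_nonneg
      nlinarith [mul_nonneg hs.le hn, mul_nonneg hs.le (sub_nonneg.2 hb)]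
    rw [poch_succ, poch_succ]
    calc poch s n * (s + n) ≤ ((s + 1) ^ n * poch b n) * ((s + 1) * (b + n)) := by
          gcongr
      _ = _ := by ring

lemma summable_oneF1 {s b x : ℝ} (hs : 0 < s) (hb : 1 ≤ b) (hx : 0 ≤ x) :
    Summable fun n : ℕ => poch s n / poch b n * x ^ n / (n.factorial : ℝ) := by
  have hb0 : 0 < b := by linarith
  refine Summable.of_nonneg_of_le (fun n => ?_) (fun n => ?_)
    (Real.summable_pow_div_factorial ((s + 1) * x))
  · have := poch_pos hs n
    have := poch_pos hb0 n
    positivity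
  · rw [mul_pow]
    gcongr
    exact (div_le_iff₀ (poch_pos hb0 n)).2 (poch_le_pow_mul_poch hs hb n)

lemma rpow_mul_exp_mul_besselI_term {a : ℝ} (ha : 0 < a) (m β r : ℝ) (k n : ℕ) :
    a ^ (2 * m - 1) * Real.exp (-β * a ^ 2) *
        ((2 * a * r / 2) ^ (2 * n + k) / ((n.factorial : ℝ) * (n + k).factorial)) =
      r ^ (2 * n + k) / ((n.factorial : ℝ) * (n + k).factorial) *
        (a ^ (2 * (m + k / 2 + n) - 1) * Real.exp (-β * a ^ 2)) := by
  have h : a ^ (2 * (m + k / 2 + n) - 1) = a ^ (2 * m - 1) * a ^ (2 * n + k) := by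
    rw [← Real.rpow_natCast, ← Real.rpow_add ha]
    congr 1
    push_cast
    ring
  rw [h, show 2 * a * r / 2 = a * r by ring, mul_pow]
  ring

lemma integral_rpow_mul_exp_neg_mul_sq {s β : ℝ} (hs : 0 < s) (hβ : 0 < β) :
    ∫ a in Ioi (0 : ℝ), a ^ (2 * s - 1) * Real.exp (-β * a ^ 2) =
      Real.Gamma s / (2 * β ^ s) := by
  have h := integral_rpow_mul_exp_neg_mul_rpow (p := 2) (q := 2 * s - 1) two_pos
    (by linarith) hβ
  simp only [Real.rpow_two] at h
  rw [h, show -(2 * s - 1 + 1) / 2 = -s by ring, show (2 * s - 1 + 1) / 2 = s by ring,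
    Real.rpow_neg hβ.le]
  field_simp

/-- For every real `m > 0`, `β > 0`, `r ≥ 0`, and integer `k ≥ 0`,
`∫₀^∞ a^{2m−1} e^{−β a²} I_k(2 a r) da
  = (Γ(m + k/2) / (2 β^{m+k/2} k!)) r^k ₁F₁(m + k/2; k+1; r²/β)`. -/
theorem nakagami_amplitude_bessel_integral (m β r : ℝ) (hm : 0 < m) (hβ : 0 < β)
    (hr : 0 ≤ r) (k : ℕ) :
    ∫ a in Set.Ioi (0:ℝ), a ^ (2 * m - 1) * Real.exp (-β * a ^ 2) * besselI k (2 * a * r) =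
      Real.Gamma (m + (k : ℝ) / 2) /
          (2 * β ^ (m + (k : ℝ) / 2) * (k.factorial : ℝ)) * r ^ k *
        oneF1 (m + (k : ℝ) / 2) ((k : ℝ) + 1) (r ^ 2 / β) := by
  set s : ℝ := m + (k : ℝ) / 2
  have hs : 0 < s := by positivity
  let F : ℕ → ℝ → ℝ := fun n a => r ^ (2 * n + k) / ((n.factorial : ℝ) * (n + k).factorial) *
        (a ^ (2 * (s + n) - 1) * Real.exp (-β * a ^ 2))
  have hF_int : ∀ n, Integrable (F n) (volume.restrict (Ioi 0)) := fun n =>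
    (integrableOn_rpow_mul_exp_neg_mul_sq hβ
      (by have : (0 : ℝ) ≤ n := n.cast_nonneg
          linarith)).const_mul _
  have hF_val : ∀ n, ∫ a in Ioi (0 : ℝ), F n a =
      Real.Gamma s / (2 * β ^ s * (k.factorial : ℝ)) * r ^ k *
        (poch s n / poch ((k : ℝ) + 1) n * (r ^ 2 / β) ^ n / (n.factorial : ℝ)) := by
    intro n
    have hp : poch ((k : ℝ) + 1) n ≠ 0 := (poch_pos (by positivity) n).ne'
    have hβs : β ^ s ≠ 0 := (Real.rpow_pos_of_pos hβ s).ne'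
    simp only [F]
    rw [integral_const_mul, integral_rpow_mul_exp_neg_mul_sq (by positivity) hβ,
      Gamma_add_natCast_eq_poch_mul hs, factorial_add_eq_factorial_mul_poch,
      Real.rpow_add hβ, Real.rpow_natCast, pow_add, pow_mul, div_pow]
    field_simp
  have hF_norm : ∀ n, ∫ a in Ioi (0 : ℝ), ‖F n a‖ = ∫ a in Ioi (0 : ℝ), F n a := fun n =>
    setIntegral_congr_fun measurableSet_Ioi fun a (ha : 0 < a) =>
      Real.norm_of_nonneg (by positivity)
  have hsum : Summable fun n => ∫ a in Ioi (0 : ℝ), ‖F n a‖ := by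
    simp only [hF_norm, hF_val]
    exact (summable_oneF1 hs (by simp) (by positivity)).mul_left _
  have hbessel : ∀ a ∈ Ioi (0 : ℝ),
      a ^ (2 * m - 1) * Real.exp (-β * a ^ 2) * besselI k (2 * a * r) = ∑' n, F n a := by
    intro a ha
    rw [besselI, ← tsum_mul_left]
    exact tsum_congr fun n => rpow_mul_exp_mul_besselI_term ha m β r k n
  rw [setIntegral_congr_fun measurableSet_Ioi hbessel,
    ← integral_tsum_of_summable_integral_norm hF_int hsum, oneF1, ← tsum_mul_left]
  exact tsum_congr hF_val
end

section
/- For every real x > 0, Γ(x + 1/2) ≤ Γ(x) · √(x + 1/2), where Γ is the Gamma function. -/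
open Real

/-- Gautschi–Wendel type bound: for every real `x > 0`,
`Γ(x + 1/2) ≤ Γ(x) √(x + 1/2)`. -/
theorem gamma_ratio_sqrt_bound (x : ℝ) (hx : 0 < x) :
    Real.Gamma (x + 1 / 2) ≤ Real.Gamma x * Real.sqrt (x + 1 / 2) := by
  have hΓ : 0 ≤ Real.Gamma x := (Real.Gamma_pos_of_pos hx).le
  calc Real.Gamma (x + 1 / 2)
      = Real.Gamma (1 / 2 * x + 1 / 2 * (x + 1)) := by ring_nf
    _ ≤ Real.Gamma x ^ (1 / 2 : ℝ) * Real.Gamma (x + 1) ^ (1 / 2 : ℝ) :=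
        Real.Gamma_mul_add_mul_le_rpow_Gamma_mul_rpow_Gamma hx (by positivity)
          (by norm_num) (by norm_num) (by norm_num)
    _ = Real.Gamma x * √x := by
        rw [Real.Gamma_add_one hx.ne', ← Real.sqrt_eq_rpow, ← Real.sqrt_eq_rpow,
          Real.sqrt_mul hx.le, mul_left_comm, Real.mul_self_sqrt hΓ, mul_comm]
    _ ≤ Real.Gamma x * √(x + 1 / 2) := by
        gcongr
        linarith
end
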